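/- For every ω ∈ (L¹ ∩ L²)(ℝ²₊) with ‖x₂ω‖₁ < ∞, the potential decays at infinity: 𝒢[ω](x) → 0 as |x| → ∞ with x ∈ ℝ²₊ (i.e. for every δ > 0 there exists R > 0 such that |𝒢[ω](x)| < δ whenever x ∈ ℝ²₊ and |x| > R). -/

import Mathlib

open MeasureTheory Real Set NNReal Filter Topology

noncomputable section

/-- The upper half plane `ℝ²₊`. -/
def H : Set (ℝ × ℝ) := {p | 0 < p.2}

/-- The half-plane Green function
`G(x,y) = (1/(4π)) log(1 + 4 x₂ y₂ / |x-y|²)` (Euclidean distance). -/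
def G (x y : ℝ × ℝ) : ℝ :=
  (1 / (4 * π)) * Real.log (1 + 4 * x.2 * y.2 / ((x.1 - y.1) ^ 2 + (x.2 - y.2) ^ 2))

/-- The potential `𝒢[ω](x) = ∫_{ℝ²₊} G(x,y) ω(y) dy`. -/
def Gpot (ω : ℝ × ℝ → ℝ) (x : ℝ × ℝ) : ℝ := ∫ y in H, G x y * ω y

/-- The kinetic energy `E(ω) = (1/2) ∫∫ G(x,y) ω(x) ω(y) dy dx`. -/
def energy (ω : ℝ × ℝ → ℝ) : ℝ :=
  (1 / 2) * ∫ x in H, ∫ y in H, G x y * ω x * ω y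

/-- The `L¹(ℝ²₊)` norm (mass). -/
def norm1 (ω : ℝ × ℝ → ℝ) : ℝ := ∫ x in H, |ω x|

/-- The `L²(ℝ²₊)` norm. -/
def norm2 (ω : ℝ × ℝ → ℝ) : ℝ := (∫ x in H, ω x ^ 2) ^ ((1 : ℝ) / 2)

/-- The impulse `‖x₂ ω‖₁ = ∫_{ℝ²₊} x₂ |ω(x)| dx`. -/
def impulse (ω : ℝ × ℝ → ℝ) : ℝ := ∫ x in H, x.2 * |ω x|

/-- `ω ∈ (L¹ ∩ L²)(ℝ²₊)`. -/
def MemL1L2 (ω : ℝ × ℝ → ℝ) : Prop :=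
  Integrable ω (volume.restrict H) ∧ Integrable (fun x => ω x ^ 2) (volume.restrict H)

/-- Finiteness of the impulse `‖x₂ ω‖₁ < ∞`. -/
def ImpulseFinite (ω : ℝ × ℝ → ℝ) : Prop :=
  Integrable (fun x : ℝ × ℝ => x.2 * |ω x|) (volume.restrict H)

/-- The admissible class `K_M`: patches `ω = 1_A` a.e. on `ℝ²₊` with
impulse `∫_A x₂ = M` and mass `|A| ≤ 1`. -/
def memK (M : ℝ) (ω : ℝ × ℝ → ℝ) : Prop :=
  Integrable ω (volume.restrict H) ∧
  ∃ A : Set (ℝ × ℝ), A ⊆ H ∧ MeasurableSet A ∧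
    (∀ᵐ x ∂volume.restrict H, ω x = A.indicator (fun _ => (1 : ℝ)) x) ∧
    (∫ x in A, x.2) = M ∧ volume A ≤ 1

/-- The admissible class `K_{M,∞}`: patches `ω = 1_A` a.e. on `ℝ²₊` with
impulse `∫_A x₂ = M`, without any mass bound. -/
def memKinf (M : ℝ) (ω : ℝ × ℝ → ℝ) : Prop :=
  Integrable ω (volume.restrict H) ∧
  ∃ A : Set (ℝ × ℝ), A ⊆ H ∧ MeasurableSet A ∧
    (∀ᵐ x ∂volume.restrict H, ω x = A.indicator (fun _ => (1 : ℝ)) x) ∧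
    (∫ x in A, x.2) = M

/-- The relaxed admissible class `K̃_M`: measurable `0 ≤ ω ≤ 1` with
mass `≤ 1` and impulse `≤ M`. -/
def memKt (M : ℝ) (ω : ℝ × ℝ → ℝ) : Prop :=
  Integrable ω (volume.restrict H) ∧
  (∀ᵐ x ∂volume.restrict H, 0 ≤ ω x ∧ ω x ≤ 1) ∧
  norm1 ω ≤ 1 ∧
  Integrable (fun x : ℝ × ℝ => x.2 * |ω x|) (volume.restrict H) ∧
  impulse ω ≤ M

/-- The set of maximizers `S_M` of the energy over `K_M`. -/
def memS (M : ℝ) (ω : ℝ × ℝ → ℝ) : Prop :=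
  memK M ω ∧ ∀ ω' : ℝ × ℝ → ℝ, memK M ω' → energy ω' ≤ energy ω

/-- The maximal energy `I_M` over `K_M`. -/
def Isup (M : ℝ) : ℝ := sSup (energy '' {ω | memK M ω})

/-- The maximal energy `I_{1,∞}` over `K_{1,∞}`. -/
def IsupInf : ℝ := sSup (energy '' {ω | memKinf 1 ω})

/-- The Steiner symmetry condition for a set `Ω ⊆ ℝ²₊`. -/
def SteinerSet (Ω : Set (ℝ × ℝ)) : Prop :=
  (∀ x₁ x₂ : ℝ, 0 < x₂ → (((x₁, x₂) : ℝ × ℝ) ∈ Ω ↔ ((-x₁, x₂) : ℝ × ℝ) ∈ Ω)) ∧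
  (∀ x₂ : ℝ, 0 < x₂ → ∀ a b : ℝ, 0 ≤ a → a ≤ b →
    ((b, x₂) : ℝ × ℝ) ∈ Ω → ((a, x₂) : ℝ × ℝ) ∈ Ω)

/-- The Steiner symmetry condition for a nonnegative function on `ℝ²₊`. -/
def SteinerFn (f : ℝ × ℝ → ℝ) : Prop :=
  (∀ x₁ x₂ : ℝ, 0 < x₂ → f (x₁, x₂) = f (-x₁, x₂)) ∧
  (∀ x₂ : ℝ, 0 < x₂ → ∀ a b : ℝ, 0 ≤ a → a ≤ b → f (b, x₂) ≤ f (a, x₂))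


/-- The truncated kernel `|t|^{-1/2}` on `(-1, 1)`. -/
def truncKernel : ℝ → ℝ := (Ioo (-1 : ℝ) 1).indicator fun t => |t| ^ (-(1 / 2) : ℝ)

lemma truncKernel_nonneg (t : ℝ) : 0 ≤ truncKernel t :=
  indicator_nonneg (fun _ _ => by positivity) t

lemma integrable_truncKernel : Integrable truncKernel := by
  rw [truncKernel, integrable_indicator_iff measurableSet_Ioo]
  have h : IntervalIntegrable (fun t : ℝ => t ^ (-(1 / 2) : ℝ)) volume 0 1 :=
    intervalIntegral.intervalIntegrable_rpow' (by norm_num)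
  have hpos : IntervalIntegrable (fun t : ℝ => |t| ^ (-(1 / 2) : ℝ)) volume 0 1 := by
    refine h.congr fun t ht => ?_
    rw [uIoc_of_le zero_le_one] at ht
    simp only [abs_of_pos ht.1]
  have hneg : IntervalIntegrable (fun t : ℝ => |t| ^ (-(1 / 2) : ℝ)) volume (-1) 0 := by
    have := hpos.symm.comp_sub_left 0
    simpa using this
  exact ((intervalIntegrable_iff_integrableOn_Ioo_of_le (by norm_num)).1 (hneg.trans hpos))

lemma measurable_truncKernel : Measurable truncKernel :=
  Measurable.indicator (by fun_prop) measurableSet_Ioo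

lemma measurableSet_H : MeasurableSet H := measurableSet_lt measurable_const measurable_snd

/-- On the half plane `4πG(x,y) ≤ 2 log(1 + 2y₂/|x-y|)`, because `x₂ ≤ y₂ + |x-y|`. -/
lemma abs_G_le_log {x y : ℝ × ℝ} (hx : x ∈ H) (hy : y ∈ H)
    (hr : 0 < (x.1 - y.1) ^ 2 + (x.2 - y.2) ^ 2) :
    |G x y| ≤ Real.log (1 + 2 * y.2 / √((x.1 - y.1) ^ 2 + (x.2 - y.2) ^ 2)) := by
  have hx' : 0 < x.2 := hx
  have hy' : 0 < y.2 := hy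
  unfold G
  set s := (x.1 - y.1) ^ 2 + (x.2 - y.2) ^ 2 with hs
  set r := √s
  have hr0 : 0 < r := Real.sqrt_pos.2 hr
  have hrs : r ^ 2 = s := Real.sq_sqrt hr.le
  have hle : x.2 - y.2 ≤ r := by
    apply Real.le_sqrt_of_sq_le
    nlinarith [sq_nonneg (x.1 - y.1)]
  have h1 : 1 + 4 * x.2 * y.2 / s ≤ (1 + 2 * y.2 / r) ^ 2 := by
    rw [← hrs]
    have : (1 + 2 * y.2 / r) ^ 2 = 1 + 4 * (y.2 + r) * y.2 / r ^ 2 := by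
      field_simp
      ring
    rw [this]
    gcongr
    linarith
  have h0 : 0 ≤ 4 * x.2 * y.2 / s := by positivity
  have hlog : 0 ≤ Real.log (1 + 4 * x.2 * y.2 / s) := Real.log_nonneg (by linarith)
  have h2 := Real.log_le_log (by linarith) h1
  rw [Real.log_pow] at h2
  push_cast at h2
  have hc : 1 / (4 * π) ≤ 1 / 2 := by
    have := Real.pi_gt_three
    gcongr
    linarith
  rw [abs_of_nonneg (by positivity)]
  calc _ ≤ 1 / 2 * Real.log (1 + 4 * x.2 * y.2 / s) := by gcongr
    _ ≤ _ := by linarith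

lemma abs_G_le_div {x y : ℝ × ℝ} (hx : x ∈ H) (hy : y ∈ H)
    (hr : 0 < (x.1 - y.1) ^ 2 + (x.2 - y.2) ^ 2) :
    |G x y| ≤ 2 * y.2 / √((x.1 - y.1) ^ 2 + (x.2 - y.2) ^ 2) := by
  have hy' : 0 < y.2 := hy
  refine (abs_G_le_log hx hy hr).trans ?_
  have := Real.log_le_sub_one_of_pos
    (show 0 < 1 + 2 * y.2 / √((x.1 - y.1) ^ 2 + (x.2 - y.2) ^ 2) by positivity)
  linarith

lemma log_one_add_inv_le {r : ℝ} (hr : 0 < r) : Real.log (1 + 1 / r) ≤ 2 * √(1 / r) := by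
  have h1 : 1 + 1 / r ≤ (1 + √(1 / r)) ^ 2 := by
    have := Real.sq_sqrt (show 0 ≤ 1 / r by positivity)
    nlinarith [Real.sqrt_nonneg (1 / r)]
  have h2 := Real.log_le_log (by positivity) h1
  rw [Real.log_pow] at h2
  have h3 := Real.log_le_sub_one_of_pos (show 0 < 1 + √(1 / r) by positivity)
  push_cast at h2
  linarith

lemma inv_sqrt_le_truncKernel_mul {a b : ℝ} (ha : a ≠ 0) (hb : b ≠ 0) (ha1 : |a| < 1)
    (hb1 : |b| < 1) : 1 / √(a ^ 2 + b ^ 2) ≤ truncKernel a * truncKernel b := by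
  have ha' : 0 < |a| := abs_pos.2 ha
  have hb' : 0 < |b| := abs_pos.2 hb
  rw [truncKernel, indicator_of_mem (by simpa using abs_lt.1 ha1),
    indicator_of_mem (by simpa using abs_lt.1 hb1), ← Real.mul_rpow ha'.le hb'.le,
    Real.rpow_neg (by positivity), ← Real.sqrt_eq_rpow, one_div]
  gcongr
  nlinarith [sq_nonneg (|a| - |b|), sq_abs a, sq_abs b]

/-- Away from the lines through `y`, the integrand of `Gpot` is bounded by a fixed integrable
function plus a small multiple of a translate of an integrable kernel. -/
lemma abs_G_mul_le {x y : ℝ × ℝ} (hx : x ∈ H) (hy : y ∈ H) (h₁ : x.1 - y.1 ≠ 0)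
    (h₂ : x.2 - y.2 ≠ 0) {η : ℝ} (hη : 0 < η) (w : ℝ) :
    |G x y * w| ≤ (2 * (y.2 * |w|) + w ^ 2 / η) +
      η * (truncKernel (x.1 - y.1) * truncKernel (x.2 - y.2)) := by
  have hy' : 0 < y.2 := hy
  have hs : 0 < (x.1 - y.1) ^ 2 + (x.2 - y.2) ^ 2 := by positivity
  have hK := mul_nonneg (truncKernel_nonneg (x.1 - y.1)) (truncKernel_nonneg (x.2 - y.2))
  rw [abs_mul]
  by_cases hnear : |x.1 - y.1| < 1 ∧ |x.2 - y.2| < 1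
  · have hlog := abs_G_le_log hx hy hs
    have hker := inv_sqrt_le_truncKernel_mul h₁ h₂ hnear.1 hnear.2
    set r := √((x.1 - y.1) ^ 2 + (x.2 - y.2) ^ 2)
    have hr : 0 < r := Real.sqrt_pos.2 hs
    have hsplit : Real.log (1 + 2 * y.2 / r) ≤ 2 * y.2 + 2 * √(1 / r) := by
      have h : 1 + 2 * y.2 / r ≤ (1 + 2 * y.2) * (1 + 1 / r) := by
        have : (1 + 2 * y.2) * (1 + 1 / r) = 1 + 2 * y.2 / r + (2 * y.2 + 1 / r) := by ring
        have : 0 < 1 / r := by positivity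
        linarith
      have h' := Real.log_le_log (by positivity) h
      rw [Real.log_mul (by positivity) (by positivity)] at h'
      have := Real.log_le_sub_one_of_pos (show 0 < 1 + 2 * y.2 by positivity)
      linarith [log_one_add_inv_le hr]
    have hyoung : 2 * √(1 / r) * |w| ≤ η * (1 / r) + w ^ 2 / η := by
      have hq := Real.sq_sqrt (show 0 ≤ 1 / r by positivity)
      have hw := sq_abs w
      have h : η * (1 / r) + w ^ 2 / η - 2 * √(1 / r) * |w|
          = (η * √(1 / r) - |w|) ^ 2 / η := by
        rw [← hw]
        nth_rewrite 1 [← hq]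
        field_simp
        ring
      have : 0 ≤ (η * √(1 / r) - |w|) ^ 2 / η := by positivity
      linarith
    calc |G x y| * |w| ≤ (2 * y.2 + 2 * √(1 / r)) * |w| := by
          gcongr
          exact hlog.trans hsplit
      _ = 2 * (y.2 * |w|) + 2 * √(1 / r) * |w| := by ring
      _ ≤ _ := by linarith [mul_le_mul_of_nonneg_left hker hη.le]
  · have hr : 1 ≤ √((x.1 - y.1) ^ 2 + (x.2 - y.2) ^ 2) := by
      rw [Real.one_le_sqrt]
      rw [not_and_or, not_lt, not_lt] at hnear
      rcases hnear with h | h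
      · nlinarith [sq_abs (x.1 - y.1), sq_nonneg (x.2 - y.2)]
      · nlinarith [sq_abs (x.2 - y.2), sq_nonneg (x.1 - y.1)]
    have h : |G x y| ≤ 2 * y.2 :=
      (abs_G_le_div hx hy hs).trans (div_le_self (by positivity) hr)
    have := mul_le_mul_of_nonneg_right h (abs_nonneg w)
    have : 0 ≤ w ^ 2 / η := by positivity
    have : 0 ≤ η * (truncKernel (x.1 - y.1) * truncKernel (x.2 - y.2)) := by positivity
    linarith

/-- The filter of points of the half plane going to infinity. -/
def atInftyH : Filter (ℝ × ℝ) := comap (fun x => x.1 ^ 2 + x.2 ^ 2) atTop ⊓ 𝓟 H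

instance : atInftyH.IsCountablyGenerated := by
  unfold atInftyH
  infer_instance

lemma eventually_mem_H : ∀ᶠ x in atInftyH, x ∈ H :=
  mem_inf_of_right (mem_principal_self H)

lemma tendsto_dist_sq_atInftyH (y : ℝ × ℝ) :
    Tendsto (fun x : ℝ × ℝ => (x.1 - y.1) ^ 2 + (x.2 - y.2) ^ 2) atInftyH atTop := by
  have h : Tendsto (fun x : ℝ × ℝ => x.1 ^ 2 + x.2 ^ 2) atInftyH atTop :=
    tendsto_comap.mono_left inf_le_left
  refine tendsto_atTop_mono (fun x => ?_)
    (tendsto_atTop_add_const_right _ (-(y.1 ^ 2 + y.2 ^ 2)) (h.atTop_div_const two_pos))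
  nlinarith [sq_nonneg (x.1 - 2 * y.1), sq_nonneg (x.2 - 2 * y.2)]

lemma tendsto_G_atInftyH {y : ℝ × ℝ} (hy : y ∈ H) :
    Tendsto (fun x => G x y) atInftyH (𝓝 0) := by
  have hd := tendsto_dist_sq_atInftyH y
  refine squeeze_zero_norm' ?_
    ((tendsto_const_nhds (x := 2 * y.2)).div_atTop (Real.tendsto_sqrt_atTop.comp hd))
  filter_upwards [eventually_mem_H, hd.eventually_gt_atTop 0] with x hx hr
  exact abs_G_le_div hx hy hr

lemma ae_sub_ne_zero (x : ℝ × ℝ) :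
    ∀ᵐ y : ℝ × ℝ, x.1 - y.1 ≠ 0 ∧ x.2 - y.2 ≠ 0 := by
  have h (c : ℝ) : ∀ᵐ t : ℝ, c - t ≠ 0 := by
    filter_upwards [Measure.ae_ne volume c] with t ht
    exact sub_ne_zero.2 ht.symm
  exact (Measure.quasiMeasurePreserving_fst.ae (h x.1)).and
    (Measure.quasiMeasurePreserving_snd.ae (h x.2))

lemma measurable_G (x : ℝ × ℝ) : Measurable (G x) := by
  unfold G
  fun_prop

lemma tendsto_Gpot_atInftyH {ω : ℝ × ℝ → ℝ} (h1 : MemL1L2 ω) (h2 : ImpulseFinite ω) :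
    Tendsto (Gpot ω) atInftyH (𝓝 0) := by
  have hKint : Integrable (fun z : ℝ × ℝ => truncKernel z.1 * truncKernel z.2) :=
    integrable_truncKernel.mul_prod integrable_truncKernel
  set K : ℝ × ℝ → ℝ := fun z => truncKernel z.1 * truncKernel z.2 with hK
  have hK0 (z) : 0 ≤ K z := mul_nonneg (truncKernel_nonneg _) (truncKernel_nonneg _)
  have hKm : Measurable K := (measurable_truncKernel.comp measurable_fst).mul
    (measurable_truncKernel.comp measurable_snd)
  set C := ∫ z, K z with hC
  have hC0 : 0 ≤ C := integral_nonneg hK0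
  rw [Metric.tendsto_nhds]
  intro δ hδ
  obtain ⟨η, hη, hηC⟩ : ∃ η : ℝ, 0 < η ∧ η * C < δ / 2 := by
    refine ⟨δ / 2 / (C + 1), by positivity, ?_⟩
    rw [div_mul_eq_mul_div, div_lt_iff₀ (by positivity)]
    nlinarith
  set g : ℝ × ℝ → ℝ := fun y => 2 * (y.2 * |ω y|) + ω y ^ 2 / η
  have hg : Integrable g (volume.restrict H) := (h2.const_mul 2).add (h1.2.div_const η)
  set F : ℝ × ℝ → ℝ × ℝ → ℝ := fun x y => max (|G x y * ω y| - η * K (x - y)) 0 with hF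
  have hFm (x) : AEStronglyMeasurable (F x) (volume.restrict H) := by
    have hGω : AEMeasurable (fun y => |G x y * ω y|) (volume.restrict H) :=
      ((measurable_G x).aemeasurable.mul h1.1.aemeasurable).abs
    have hKx : Measurable fun y => η * K (x - y) :=
      (hKm.comp (measurable_const.sub measurable_id)).const_mul η
    exact ((hGω.sub hKx.aemeasurable).max aemeasurable_const).aestronglyMeasurable
  have hFle (x) (hx : x ∈ H) : ∀ᵐ y ∂volume.restrict H, ‖F x y‖ ≤ g y := by
    filter_upwards [ae_restrict_mem measurableSet_H, ae_restrict_of_ae (ae_sub_ne_zero x)]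
      with y hy hxy
    have hy' : 0 < y.2 := hy
    rw [Real.norm_of_nonneg (le_max_right _ _)]
    refine max_le ?_ (by positivity)
    have := abs_G_mul_le hx hy hxy.1 hxy.2 hη (ω y)
    simp only [hK, g, Prod.fst_sub, Prod.snd_sub]
    linarith
  have hFlim : Tendsto (fun x => ∫ y in H, F x y) atInftyH (𝓝 0) := by
    have := tendsto_integral_filter_of_dominated_convergence (μ := volume.restrict H)
      (F := F) (f := fun _ => 0) (l := atInftyH) g (.of_forall hFm)
      (eventually_mem_H.mono hFle) hg ?_
    · simpa using this
    filter_upwards [ae_restrict_mem measurableSet_H] with y hy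
    have hG : Tendsto (fun x => |G x y * ω y|) atInftyH (𝓝 0) := by
      simpa using ((tendsto_G_atInftyH hy).mul_const (ω y)).abs
    refine squeeze_zero (fun x => le_max_right _ _) (fun x => ?_) hG
    exact max_le (by linarith [mul_nonneg hη.le (hK0 (x - y))]) (abs_nonneg _)
  filter_upwards [eventually_mem_H, hFlim.eventually_lt_const (half_pos hδ)] with x hx hlt
  have hKx : Integrable fun y => K (x - y) := hKint.comp_sub_left x
  have hFi : Integrable (F x) (volume.restrict H) := hg.mono' (hFm x) (hFle x hx)
  have hKH : ∫ y in H, K (x - y) ≤ C := by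
    rw [hC, ← integral_sub_left_eq_self K volume x]
    exact setIntegral_le_integral hKx (.of_forall fun y => hK0 _)
  rw [dist_zero_right]
  calc ‖Gpot ω x‖ ≤ ∫ y in H, (F x y + η * K (x - y)) := by
        refine norm_integral_le_of_norm_le (hFi.add (hKx.restrict.const_mul η)) ?_
        refine .of_forall fun y => ?_
        have := le_max_left (|G x y * ω y| - η * K (x - y)) 0
        simp only [hF, Real.norm_eq_abs]
        linarith
    _ = (∫ y in H, F x y) + η * ∫ y in H, K (x - y) := by
        rw [integral_add hFi (hKx.restrict.const_mul η), integral_const_mul]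
    _ < δ := by linarith [mul_le_mul_of_nonneg_left hKH hη.le]

/-- decay of the potential at infinity, for `ω ∈ (L¹ ∩ L²)(ℝ²₊)` with
finite impulse. -/
theorem gpot_decay (ω : ℝ × ℝ → ℝ) (h1 : MemL1L2 ω) (h2 : ImpulseFinite ω) :
    ∀ δ : ℝ, 0 < δ → ∃ R : ℝ, 0 < R ∧
      ∀ x ∈ H, R ^ 2 < x.1 ^ 2 + x.2 ^ 2 → |Gpot ω x| < δ := by
  intro δ hδ
  have h := (tendsto_Gpot_atInftyH h1 h2).eventually (Metric.ball_mem_nhds 0 hδ)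
  rw [atInftyH, eventually_inf_principal, eventually_comap] at h
  obtain ⟨T, hT⟩ := h.exists_forall_of_atTop
  refine ⟨max T 1, by positivity, fun x hx hxR => ?_⟩
  have hTx : T ≤ x.1 ^ 2 + x.2 ^ 2 := by
    nlinarith [le_max_left T 1, le_max_right T 1]
  simpa using hT _ hTx x rfl hx
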